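/- For every integer n > 1, the series ∑_{k=1}^{∞} c*_n(k)/k converges and its sum equals −Λ*(n); that is, Λ*(n) = −∑_{k=1}^{∞} c*_n(k)/k. -/

import Mathlib

open Polynomial Finset

/-- The finset of unitary divisors of `n`: divisors `d` of `n` with `gcd (d, n / d) = 1`. -/
def unitaryDivisors (n : ℕ) : Finset ℕ :=
  n.divisors.filter fun d => Nat.Coprime d (n / d)

/-- `d ∣∣ n`: `d` is a unitary divisor of `n`. -/
def IsUnitaryDivisor (d n : ℕ) : Prop := d ∈ unitaryDivisors n

/-- `(j, n)_*`: the greatest `d` such that `d ∣ j` and `d` is a unitary divisor of `n`. -/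
def unitaryGcd (j n : ℕ) : ℕ :=
  ((unitaryDivisors n).filter fun d => d ∣ j).sup id

/-- `κ(n)`: the squarefree kernel (radical) of `n`. -/
def kernel (n : ℕ) : ℕ := ∏ p ∈ n.primeFactors, p

/-- `φ*(n)`: the unitary Euler totient function. -/
def unitaryTotient (n : ℕ) : ℕ :=
  ((Finset.Icc 1 n).filter fun j => unitaryGcd j n = 1).card

/-- `μ*(n) = (-1)^{ω(n)}`: the unitary Moebius function. -/
def unitaryMoebius (n : ℕ) : ℤ := (-1) ^ n.primeFactors.card

/-- `Φ*_n`: the unitary cyclotomic polynomial (over `ℂ`). -/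
noncomputable def unitaryCyclotomic (n : ℕ) : Polynomial ℂ :=
  ∏ j ∈ (Finset.Icc 1 n).filter fun j => unitaryGcd j n = 1,
    (X - C (Complex.exp (2 * (Real.pi : ℂ) * Complex.I * (j : ℂ) / (n : ℂ))))

/-- `c*_n(k)`: the unitary Ramanujan sum. -/
noncomputable def unitaryRamanujan (n k : ℕ) : ℂ :=
  ∑ j ∈ (Finset.Icc 1 n).filter fun j => unitaryGcd j n = 1,
    Complex.exp (2 * (Real.pi : ℂ) * Complex.I * (j : ℂ) * (k : ℂ) / (n : ℂ))

/-- `c_n(k)`: the classical Ramanujan sum. -/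
noncomputable def ramanujanSum (n k : ℕ) : ℂ :=
  ∑ j ∈ (Finset.Icc 1 n).filter fun j => Nat.Coprime j n,
    Complex.exp (2 * (Real.pi : ℂ) * Complex.I * (j : ℂ) * (k : ℂ) / (n : ℂ))

/-- The unitary convolution `(f × g)(n) = ∑_{d ∣∣ n} f(d) g(n/d)`. -/
noncomputable def unitaryConv (f g : ℕ → ℂ) (n : ℕ) : ℂ :=
  ∑ d ∈ unitaryDivisors n, f d * g (n / d)

/-- `Λ*(n)`: the unitary von Mangoldt function, `a log p` for `n = p^a`, else `0`. -/
noncomputable def unitaryVonMangoldt (n : ℕ) : ℝ :=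
  if IsPrimePow n then (n.factorization n.minFac : ℝ) * Real.log n.minFac else 0

theorem sum_Icc_one_pow_of_pow_eq_one {K : Type*} [Field K] [DecidableEq K] {z : K} {m : ℕ}
    (hz : z ^ m = 1) :
    ∑ i ∈ Icc 1 m, z ^ i = if z = 1 then (m : K) else 0 := by
  split_ifs with h
  · simp [h]
  · have hgeom : ∑ i ∈ range m, z ^ i = 0 := by
      have := mul_geom_sum z m
      rw [hz, sub_self] at this
      exact (mul_eq_zero.mp this).resolve_left (sub_ne_zero.mpr h)
    have hshift : ∑ i ∈ Icc 1 m, z ^ i = ∑ i ∈ range m, z ^ (i + 1) := by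
      rw [range_eq_Ico, sum_Ico_add' (fun i => z ^ i) 0 m 1]
      rfl
    rw [hshift]
    simp_rw [pow_succ]
    rw [← sum_mul, hgeom, zero_mul]

theorem sum_exp_filter_dvd {n d : ℕ} (hn : n ≠ 0) (hd : d ∣ n) (k : ℕ) :
    ∑ j ∈ (Icc 1 n).filter (d ∣ ·),
      Complex.exp (2 * (Real.pi : ℂ) * Complex.I * (j : ℂ) * (k : ℂ) / (n : ℂ)) =
      if n / d ∣ k then ((n / d : ℕ) : ℂ) else 0 := by
  obtain ⟨e, rfl⟩ := hd
  have hd0 : d ≠ 0 := left_ne_zero_of_mul hn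
  have he0 : e ≠ 0 := right_ne_zero_of_mul hn
  rw [Nat.mul_div_cancel_left e (Nat.pos_of_ne_zero hd0)]
  have hfilter : (Icc 1 (d * e)).filter (d ∣ ·) = (Icc 1 e).image (d * ·) := by
    ext j
    simp only [mem_filter, mem_Icc, mem_image]
    constructor
    · rintro ⟨⟨h1, h2⟩, i, rfl⟩
      exact ⟨i, ⟨Nat.pos_of_mul_pos_left h1,
        Nat.le_of_mul_le_mul_left h2 (Nat.pos_of_ne_zero hd0)⟩, rfl⟩
    · rintro ⟨i, ⟨h1, h2⟩, rfl⟩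
      exact ⟨⟨Nat.mul_pos (Nat.pos_of_ne_zero hd0) h1, Nat.mul_le_mul_left d h2⟩,
        dvd_mul_right d i⟩
  have hprim := Complex.isPrimitiveRoot_exp e he0
  set z := Complex.exp (2 * Real.pi * Complex.I / e) with hz
  rw [hfilter, sum_image fun a _ b _ h => Nat.eq_of_mul_eq_mul_left (Nat.pos_of_ne_zero hd0) h]
  have hterm (i : ℕ) : Complex.exp
      (2 * (Real.pi : ℂ) * Complex.I * ((d * i : ℕ) : ℂ) * (k : ℂ) / ((d * e : ℕ) : ℂ)) =
      (z ^ k) ^ i := by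
    rw [hz, ← pow_mul, ← Complex.exp_nat_mul]
    congr 1
    have : (d : ℂ) ≠ 0 := by exact_mod_cast hd0
    have : (e : ℂ) ≠ 0 := by exact_mod_cast he0
    push_cast
    field_simp
  simp_rw [hterm]
  have hroot : (z ^ k) ^ e = 1 := by rw [pow_right_comm, hprim.pow_eq_one, one_pow]
  rw [sum_Icc_one_pow_of_pow_eq_one hroot]
  simp only [hprim.pow_eq_one_iff_dvd]

theorem sum_powerset_neg_one_pow_card_cast {ι R : Type*} [CommRing R] [DecidableEq ι]
    (s : Finset ι) : ∑ t ∈ s.powerset, (-1 : R) ^ #t = if s = ∅ then 1 else 0 := by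
  have := congrArg (Int.cast : ℤ → R) (sum_powerset_neg_one_pow_card (x := s))
  push_cast at this
  exact this

theorem sum_powerset_insert_neg_one_pow_card_mul_sum {ι R : Type*} [CommRing R] [DecidableEq ι]
    {a : ι} {s : Finset ι} (ha : a ∉ s) (g : ι → R) :
    ∑ t ∈ (insert a s).powerset, (-1 : R) ^ #t * ∑ p ∈ t, g p =
      if s = ∅ then -g a else 0 := by
  rw [sum_powerset_insert ha, ← sum_add_distrib]
  have hterm : ∀ t ∈ s.powerset, (-1 : R) ^ #t * ∑ p ∈ t, g p +
      (-1) ^ #(insert a t) * ∑ p ∈ insert a t, g p = (-1) ^ #t * (-g a) := by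
    intro t ht
    have hat : a ∉ t := fun h => ha (mem_powerset.mp ht h)
    rw [card_insert_of_notMem hat, sum_insert hat]
    ring
  rw [sum_congr rfl hterm, ← sum_mul, sum_powerset_neg_one_pow_card_cast]
  split_ifs <;> simp

/-- The unitary divisor of `n` whose set of prime factors is `s`, for `s ⊆ n.primeFactors`. -/
def unitaryPart (n : ℕ) (s : Finset ℕ) : ℕ := ∏ p ∈ s, p ^ n.factorization p

theorem unitaryPart_dvd_iff {n : ℕ} {s : Finset ℕ} (hs : s ⊆ n.primeFactors) (j : ℕ) :
    unitaryPart n s ∣ j ↔ ∀ p ∈ s, p ^ n.factorization p ∣ j := by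
  refine ⟨fun h p hp => (dvd_prod_of_mem (fun p => p ^ n.factorization p) hp).trans h, fun h => ?_⟩
  refine Finset.prod_dvd_of_isRelPrime (fun p hp q hq hpq => ?_) h
  rw [Function.onFun, ← Nat.coprime_iff_isRelPrime]
  exact Nat.coprime_pow_primes _ _ (Nat.prime_of_mem_primeFactors (hs hp))
    (Nat.prime_of_mem_primeFactors (hs hq)) hpq

theorem unitaryPart_dvd {n : ℕ} {s : Finset ℕ} (hs : s ⊆ n.primeFactors) :
    unitaryPart n s ∣ n :=
  (unitaryPart_dvd_iff hs n).mpr fun p _ => Nat.ordProj_dvd n p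

theorem div_unitaryPart_ne_zero {n : ℕ} (hn : n ≠ 0) {s : Finset ℕ} (hs : s ⊆ n.primeFactors) :
    n / unitaryPart n s ≠ 0 :=
  ne_zero_of_dvd_ne_zero hn (Nat.div_dvd_of_dvd (unitaryPart_dvd hs))

theorem log_unitaryPart {n : ℕ} {s : Finset ℕ} (hs : s ⊆ n.primeFactors) :
    Real.log (unitaryPart n s) = ∑ p ∈ s, n.factorization p * Real.log p := by
  rw [unitaryPart, Nat.cast_prod, Real.log_prod]
  · simp
  · intro p hp
    have := (Nat.prime_of_mem_primeFactors (hs hp)).ne_zero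
    positivity

theorem unitaryGcd_eq_one_iff {n : ℕ} (hn : n ≠ 0) (j : ℕ) :
    unitaryGcd j n = 1 ↔ n.primeFactors.filter (fun p => p ^ n.factorization p ∣ j) = ∅ := by
  rw [filter_eq_empty_iff]
  constructor
  · intro h p hp hpj
    have hprime := Nat.prime_of_mem_primeFactors hp
    have hmem : p ^ n.factorization p ∈ (unitaryDivisors n).filter fun d => d ∣ j := by
      simp only [unitaryDivisors, mem_filter, Nat.mem_divisors]
      exact ⟨⟨⟨Nat.ordProj_dvd n p, hn⟩, (Nat.coprime_ordCompl hprime hn).pow_left _⟩, hpj⟩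
    have hle : p ^ n.factorization p ≤ 1 := h ▸ le_sup (f := id) hmem
    exact absurd hle (not_le.mpr (Nat.one_lt_pow
      (hprime.factorization_pos_of_dvd hn (Nat.dvd_of_mem_primeFactors hp)).ne' hprime.one_lt))
  · intro h
    refine le_antisymm (Finset.sup_le fun d hd => ?_) (le_sup (f := id) (b := 1) ?_)
    · simp only [unitaryDivisors, mem_filter, Nat.mem_divisors] at hd
      obtain ⟨⟨⟨hdn, -⟩, hcop⟩, hdj⟩ := hd
      by_contra hd1
      obtain ⟨p, hp, hpd⟩ := Nat.exists_prime_and_dvd (n := d) fun h => hd1 (by simp [h])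
      refine h (Nat.mem_primeFactors.mpr ⟨hp, hpd.trans hdn, hn⟩) (dvd_trans ?_ hdj)
      have hcop' : Nat.Coprime (p ^ n.factorization p) (n / d) :=
        (hcop.coprime_dvd_left hpd).pow_left _
      refine hcop'.dvd_of_dvd_mul_right ?_
      rw [Nat.mul_div_cancel' hdn]
      exact Nat.ordProj_dvd n p
    · simp [unitaryDivisors, hn]

theorem unitaryRamanujan_eq_sum_powerset {n : ℕ} (hn : n ≠ 0) (k : ℕ) :
    unitaryRamanujan n k = ∑ s ∈ n.primeFactors.powerset, (-1) ^ #s *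
      if n / unitaryPart n s ∣ k then ((n / unitaryPart n s : ℕ) : ℂ) else 0 := by
  have hind (j : ℕ) : (if unitaryGcd j n = 1 then (1 : ℂ) else 0) =
      ∑ s ∈ n.primeFactors.powerset, if unitaryPart n s ∣ j then (-1) ^ #s else 0 := by
    simp only [unitaryGcd_eq_one_iff hn]
    rw [← sum_powerset_neg_one_pow_card_cast, ← sum_filter]
    refine sum_congr ?_ fun _ _ => rfl
    ext s
    simp only [mem_powerset, mem_filter]
    refine ⟨fun h => ?_, fun ⟨hs, h⟩ p hp => ?_⟩
    · have hs := h.trans (filter_subset _ _)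
      exact ⟨hs, (unitaryPart_dvd_iff hs j).mpr fun p hp => (mem_filter.mp (h hp)).2⟩
    · exact mem_filter.mpr ⟨hs hp, (unitaryPart_dvd_iff hs j).mp h p hp⟩
  have hterm : ∀ s ∈ n.primeFactors.powerset, ((-1) ^ #s *
      if n / unitaryPart n s ∣ k then ((n / unitaryPart n s : ℕ) : ℂ) else 0) =
      ∑ j ∈ Icc 1 n, (if unitaryPart n s ∣ j then (-1) ^ #s else 0) *
        Complex.exp (2 * (Real.pi : ℂ) * Complex.I * (j : ℂ) * (k : ℂ) / (n : ℂ)) := by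
    intro s hs
    rw [← sum_exp_filter_dvd hn (unitaryPart_dvd (mem_powerset.mp hs)), sum_filter, mul_sum]
    refine sum_congr rfl fun j _ => ?_
    split_ifs <;> simp
  rw [sum_congr rfl hterm, sum_comm, unitaryRamanujan, sum_filter]
  refine sum_congr rfl fun j _ => ?_
  rw [← sum_mul, ← hind]
  split_ifs <;> simp

theorem sum_Icc_ite_dvd_div_eq_harmonic {e : ℕ} (he : e ≠ 0) (N : ℕ) :
    ∑ k ∈ Icc 1 N, (if e ∣ k then (e : ℚ) else 0) / k = harmonic (N / e) := by
  induction N with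
  | zero => simp
  | succ N ih =>
    rw [sum_Icc_succ_top (by omega), ih, Nat.succ_div]
    split_ifs with h
    · rw [harmonic_succ]
      obtain ⟨m, hm⟩ := h
      have hdiv : N / e + 1 = m := by
        rw [← Nat.succ_div_of_dvd (hm ▸ dvd_mul_right e m), hm,
          Nat.mul_div_cancel_left m (Nat.pos_of_ne_zero he)]
      have he' : (e : ℚ) ≠ 0 := by exact_mod_cast he
      rw [hdiv, hm]
      push_cast
      congr 1
      rw [div_mul_eq_div_div, div_self he', one_div]
    · simp

theorem tendsto_harmonic_div_sub_log {e : ℕ} (he : e ≠ 0) :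
    Filter.Tendsto (fun N : ℕ => (harmonic (N / e) : ℝ) - Real.log N) Filter.atTop
      (nhds (Real.eulerMascheroniConstant - Real.log e)) := by
  have he' : (e : ℝ) ≠ 0 := by exact_mod_cast he
  have hdiv : Filter.Tendsto (fun N : ℕ => N / e) Filter.atTop Filter.atTop :=
    Nat.tendsto_div_const_atTop he
  have hH := Real.tendsto_harmonic_sub_log.comp hdiv
  have hratio : Filter.Tendsto (fun N : ℕ => ((N / e : ℕ) : ℝ) / N) Filter.atTop
      (nhds (e : ℝ)⁻¹) := by
    refine ((tendsto_nat_floor_mul_div_atTop (R := ℝ) (a := (e : ℝ)⁻¹) (by positivity)).comp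
      tendsto_natCast_atTop_atTop).congr fun N => ?_
    simp only [Function.comp_apply]
    rw [inv_mul_eq_div, Nat.floor_div_eq_div]
  have hlog := hratio.log (inv_ne_zero he')
  rw [Real.log_inv] at hlog
  rw [sub_eq_add_neg]
  refine (hH.add hlog).congr' ?_
  filter_upwards [Filter.eventually_gt_atTop 0, hdiv.eventually_gt_atTop 0] with N hN hNe
  have h1 : (N : ℝ) ≠ 0 := by positivity
  have h2 : ((N / e : ℕ) : ℝ) ≠ 0 := by exact_mod_cast hNe.ne'
  rw [Real.log_div h2 h1]
  simp

theorem sum_powerset_neg_one_pow_card_mul_log_unitaryPart {n : ℕ} (hn : 1 < n) :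
    ∑ s ∈ n.primeFactors.powerset, (-1 : ℝ) ^ #s * Real.log (unitaryPart n s) =
      -unitaryVonMangoldt n := by
  rw [sum_congr rfl fun s hs => by rw [log_unitaryPart (mem_powerset.mp hs)]]
  have hmin : n.minFac ∈ n.primeFactors :=
    Nat.mem_primeFactors.mpr ⟨Nat.minFac_prime hn.ne', n.minFac_dvd, by omega⟩
  rw [← insert_erase hmin, sum_powerset_insert_neg_one_pow_card_mul_sum (notMem_erase _ _),
    unitaryVonMangoldt]
  have hiff : n.primeFactors.erase n.minFac = ∅ ↔ IsPrimePow n := by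
    rw [isPrimePow_iff_card_primeFactors_eq_one, ← card_eq_zero, card_erase_of_mem hmin]
    have := card_pos.mpr ⟨_, hmin⟩
    omega
  simp only [hiff]
  split_ifs <;> simp

theorem sum_unitaryRamanujan_div_eq {n : ℕ} (hn : 1 < n) (N : ℕ) :
    ∑ k ∈ Icc 1 N, unitaryRamanujan n k / (k : ℂ) =
      ((∑ s ∈ n.primeFactors.powerset, (-1 : ℝ) ^ #s *
        ((harmonic (N / (n / unitaryPart n s)) : ℝ) - Real.log N) : ℝ) : ℂ) := by
  have hn0 : n ≠ 0 := by omega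
  have hcancel : ∑ s ∈ n.primeFactors.powerset, (-1 : ℝ) ^ #s * Real.log N = 0 := by
    rw [← sum_mul, sum_powerset_neg_one_pow_card_cast, if_neg, zero_mul]
    rw [Nat.primeFactors_eq_empty]
    omega
  simp_rw [mul_sub]
  rw [sum_sub_distrib, hcancel, sub_zero, Complex.ofReal_sum]
  simp_rw [unitaryRamanujan_eq_sum_powerset hn0, sum_div]
  rw [sum_comm]
  refine sum_congr rfl fun s hs => ?_
  rw [← sum_Icc_ite_dvd_div_eq_harmonic (div_unitaryPart_ne_zero hn0 (mem_powerset.mp hs))]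
  push_cast
  rw [mul_sum]
  refine sum_congr rfl fun k _ => ?_
  rw [mul_div_assoc]
  split_ifs <;> simp

/-- for `n > 1`, the series `∑_{k ≥ 1} c*_n(k)/k` converges with sum `-Λ*(n)`. -/
theorem unitaryRamanujan_series_eq_neg_vonMangoldt (n : ℕ) (hn : 1 < n) :
    Filter.Tendsto
      (fun N => ∑ k ∈ Finset.Icc 1 N, unitaryRamanujan n k / (k : ℂ))
      Filter.atTop (nhds (-((unitaryVonMangoldt n : ℝ) : ℂ))) := by
  have hn0 : n ≠ 0 := by omega
  simp_rw [sum_unitaryRamanujan_div_eq hn]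
  rw [← Complex.ofReal_neg]
  refine Filter.Tendsto.ofReal ?_
  have hlim : ∑ s ∈ n.primeFactors.powerset, (-1 : ℝ) ^ #s *
      (Real.eulerMascheroniConstant - Real.log (n / unitaryPart n s : ℕ)) =
      -unitaryVonMangoldt n := by
    rw [← sum_powerset_neg_one_pow_card_mul_log_unitaryPart hn, ← sub_eq_zero, ← sum_sub_distrib]
    have hterm : ∀ s ∈ n.primeFactors.powerset, (-1 : ℝ) ^ #s *
        (Real.eulerMascheroniConstant - Real.log (n / unitaryPart n s : ℕ)) -
        (-1) ^ #s * Real.log (unitaryPart n s) =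
        (-1) ^ #s * (Real.eulerMascheroniConstant - Real.log n) := by
      intro s hs
      have hdvd := unitaryPart_dvd (mem_powerset.mp hs)
      have hd : (unitaryPart n s : ℝ) ≠ 0 := by exact_mod_cast ne_zero_of_dvd_ne_zero hn0 hdvd
      rw [Nat.cast_div hdvd hd, Real.log_div (by exact_mod_cast hn0) hd]
      ring
    rw [sum_congr rfl hterm, ← sum_mul, sum_powerset_neg_one_pow_card_cast, if_neg, zero_mul]
    rw [Nat.primeFactors_eq_empty]
    omega
  rw [← hlim]
  refine tendsto_finsetSum _ fun s hs => (tendsto_harmonic_div_sub_log ?_).const_mul _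
  exact div_unitaryPart_ne_zero hn0 (mem_powerset.mp hs)
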